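/- arXiv:1411.3386 — 2 statements merged into one kernel-verified Lean document; each statement's English description precedes it below -/
import Mathlib

section
/- Let F, H : ℝ² → ℝ be continuously differentiable, and let U₀, V₀ : ℝ² → ℝ be three-times continuously differentiable functions satisfying ΔU₀ + F(U₀, V₀) = 0 and ΔV₀ + H(U₀, V₀) = 0 on all of ℝ², where Δ = ∂²/∂s₁² + ∂²/∂s₂². Fix a real constant c (representing cot θⱼ), and define U₁ = −(c/2) s₂² ∂₁U₀ + c s₁ s₂ ∂₂U₀ and V₁ = −(c/2) s₂² ∂₁V₀ + c s₁ s₂ ∂₂V₀. Then at every point of ℝ²: ΔU₁ + F_U(U₀,V₀) U₁ + F_V(U₀,V₀) V₁ = −c (∂₁U₀ − 2 s₁ ∂₂∂₂U₀), and ΔV₁ + H_U(U₀,V₀) U₁ + H_V(U₀,V₀) V₁ = −c (∂₁V₀ − 2 s₁ ∂₂∂₂V₀). -/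
open Real

/-- Partial derivative with respect to the first coordinate of a function `ℝ² → ℝ`
(written in curried form). -/
noncomputable def pd1 (g : ℝ → ℝ → ℝ) : ℝ → ℝ → ℝ := fun a b => deriv (fun x => g x b) a

/-- Partial derivative with respect to the second coordinate of a function `ℝ² → ℝ`
(written in curried form). -/
noncomputable def pd2 (g : ℝ → ℝ → ℝ) : ℝ → ℝ → ℝ := fun a b => deriv (fun y => g a y) b

/-- The planar Laplacian `Δ = ∂₁∂₁ + ∂₂∂₂`. -/
noncomputable def lap (g : ℝ → ℝ → ℝ) : ℝ → ℝ → ℝ :=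
  fun a b => pd1 (pd1 g) a b + pd2 (pd2 g) a b

section PartialDerivatives

variable {g : ℝ → ℝ → ℝ}

theorem hasDerivAt_slice_fst_fderiv (hg : Differentiable ℝ (Function.uncurry g)) (a b : ℝ) :
    HasDerivAt (fun x => g x b) (fderiv ℝ (Function.uncurry g) (a, b) (1, 0)) a := by
  have h := (hg (a, b)).hasFDerivAt.comp_hasDerivAt a
    ((hasDerivAt_id a).prodMk (hasDerivAt_const a b))
  exact h

theorem hasDerivAt_slice_snd_fderiv (hg : Differentiable ℝ (Function.uncurry g)) (a b : ℝ) :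
    HasDerivAt (fun y => g a y) (fderiv ℝ (Function.uncurry g) (a, b) (0, 1)) b := by
  have h := (hg (a, b)).hasFDerivAt.comp_hasDerivAt b
    ((hasDerivAt_const b a).prodMk (hasDerivAt_id b))
  exact h

theorem pd1_eq_fderiv (hg : Differentiable ℝ (Function.uncurry g)) (a b : ℝ) :
    pd1 g a b = fderiv ℝ (Function.uncurry g) (a, b) (1, 0) :=
  (hasDerivAt_slice_fst_fderiv hg a b).deriv

theorem pd2_eq_fderiv (hg : Differentiable ℝ (Function.uncurry g)) (a b : ℝ) :
    pd2 g a b = fderiv ℝ (Function.uncurry g) (a, b) (0, 1) :=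
  (hasDerivAt_slice_snd_fderiv hg a b).deriv

theorem hasDerivAt_pd1 (hg : Differentiable ℝ (Function.uncurry g)) (a b : ℝ) :
    HasDerivAt (fun x => g x b) (pd1 g a b) a :=
  (hasDerivAt_slice_fst_fderiv hg a b).differentiableAt.hasDerivAt

theorem hasDerivAt_pd2 (hg : Differentiable ℝ (Function.uncurry g)) (a b : ℝ) :
    HasDerivAt (fun y => g a y) (pd2 g a b) b :=
  (hasDerivAt_slice_snd_fderiv hg a b).differentiableAt.hasDerivAt

theorem uncurry_pd1 (hg : Differentiable ℝ (Function.uncurry g)) :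
    Function.uncurry (pd1 g) = fun p => fderiv ℝ (Function.uncurry g) p (1, 0) :=
  funext fun p => pd1_eq_fderiv hg p.1 p.2

theorem uncurry_pd2 (hg : Differentiable ℝ (Function.uncurry g)) :
    Function.uncurry (pd2 g) = fun p => fderiv ℝ (Function.uncurry g) p (0, 1) :=
  funext fun p => pd2_eq_fderiv hg p.1 p.2

theorem contDiff_pd1 {n m : WithTop ℕ∞} (hg : ContDiff ℝ n (Function.uncurry g))
    (hmn : m + 1 ≤ n) : ContDiff ℝ m (Function.uncurry (pd1 g)) := by
  rw [uncurry_pd1 ((hg.of_le (le_add_self.trans hmn)).differentiable one_ne_zero)]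
  exact (hg.fderiv_right hmn).clm_apply contDiff_const

theorem contDiff_pd2 {n m : WithTop ℕ∞} (hg : ContDiff ℝ n (Function.uncurry g))
    (hmn : m + 1 ≤ n) : ContDiff ℝ m (Function.uncurry (pd2 g)) := by
  rw [uncurry_pd2 ((hg.of_le (le_add_self.trans hmn)).differentiable one_ne_zero)]
  exact (hg.fderiv_right hmn).clm_apply contDiff_const

theorem pd1_pd2_comm (hg : ContDiff ℝ 2 (Function.uncurry g)) :
    pd1 (pd2 g) = pd2 (pd1 g) := by
  have hd : Differentiable ℝ (Function.uncurry g) := hg.differentiable two_ne_zero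
  have h11 : (1 : WithTop ℕ∞) + 1 ≤ 2 := by norm_num
  have hd' : Differentiable ℝ (fderiv ℝ (Function.uncurry g)) :=
    (hg.fderiv_right h11).differentiable one_ne_zero
  funext a b
  rw [pd1_eq_fderiv ((contDiff_pd2 hg h11).differentiable one_ne_zero),
    pd2_eq_fderiv ((contDiff_pd1 hg h11).differentiable one_ne_zero),
    uncurry_pd1 hd, uncurry_pd2 hd,
    fderiv_clm_apply (hd' _) (differentiableAt_const _),
    fderiv_clm_apply (hd' _) (differentiableAt_const _)]
  have hs : IsSymmSndFDerivAt ℝ (Function.uncurry g) (a, b) :=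
    hg.contDiffAt.isSymmSndFDerivAt (by simp)
  simpa using hs.eq (1, 0) (0, 1)

end PartialDerivatives

section ChainRule

variable {F U V : ℝ → ℝ → ℝ}

theorem hasDerivAt_comp_pd {u v : ℝ → ℝ} {u' v' t : ℝ}
    (hF : Differentiable ℝ (Function.uncurry F)) (hu : HasDerivAt u u' t)
    (hv : HasDerivAt v v' t) :
    HasDerivAt (fun x => F (u x) (v x))
      (pd1 F (u t) (v t) * u' + pd2 F (u t) (v t) * v') t := by
  have h := (hF (u t, v t)).hasFDerivAt.comp_hasDerivAt t (hu.prodMk hv)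
  have hsplit : ((u', v') : ℝ × ℝ) = u' • (1, 0) + v' • (0, 1) := by simp
  rw [hsplit, map_add, map_smul, map_smul, ← pd1_eq_fderiv hF, ← pd2_eq_fderiv hF,
    smul_eq_mul, smul_eq_mul, mul_comm u', mul_comm v'] at h
  exact h

theorem pd1_comp (hF : Differentiable ℝ (Function.uncurry F))
    (hU : Differentiable ℝ (Function.uncurry U)) (hV : Differentiable ℝ (Function.uncurry V))
    (a b : ℝ) : pd1 (fun x y => F (U x y) (V x y)) a b =
      pd1 F (U a b) (V a b) * pd1 U a b + pd2 F (U a b) (V a b) * pd1 V a b :=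
  (hasDerivAt_comp_pd hF (hasDerivAt_pd1 hU a b) (hasDerivAt_pd1 hV a b)).deriv

theorem pd2_comp (hF : Differentiable ℝ (Function.uncurry F))
    (hU : Differentiable ℝ (Function.uncurry U)) (hV : Differentiable ℝ (Function.uncurry V))
    (a b : ℝ) : pd2 (fun x y => F (U x y) (V x y)) a b =
      pd1 F (U a b) (V a b) * pd2 U a b + pd2 F (U a b) (V a b) * pd2 V a b :=
  (hasDerivAt_comp_pd hF (hasDerivAt_pd2 hU a b) (hasDerivAt_pd2 hV a b)).deriv

end ChainRule

section StaticComponent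

/-- The first-order operator `-(c/2) s₂² ∂₁ + c s₁ s₂ ∂₂`. -/
noncomputable def staticComponent (c : ℝ) (g : ℝ → ℝ → ℝ) : ℝ → ℝ → ℝ :=
  fun s₁ s₂ => -(c / 2) * s₂ ^ 2 * pd1 g s₁ s₂ + c * s₁ * s₂ * pd2 g s₁ s₂

/-- The commutator of the Laplacian with `staticComponent c` is `-c (∂₁ - 2 s₁ ∂₂∂₂)`. -/
theorem lap_staticComponent {g : ℝ → ℝ → ℝ} (hg : ContDiff ℝ 3 (Function.uncurry g))
    (c a b : ℝ) :
    lap (staticComponent c g) a b =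
      staticComponent c (lap g) a b - c * (pd1 g a b - 2 * a * pd2 (pd2 g) a b) := by
  have h21 : (2 : WithTop ℕ∞) + 1 ≤ 3 := by norm_num
  have h11 : (1 : WithTop ℕ∞) + 1 ≤ 2 := by norm_num
  have hg2 : ContDiff ℝ 2 (Function.uncurry g) := hg.of_le (by norm_num)
  have c1 := contDiff_pd1 hg h21
  have c2 := contDiff_pd2 hg h21
  have d1 := c1.differentiable two_ne_zero
  have d2 := c2.differentiable two_ne_zero
  have d11 := (contDiff_pd1 c1 h11).differentiable one_ne_zero
  have d12 := (contDiff_pd1 c2 h11).differentiable one_ne_zero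
  have d21 := (contDiff_pd2 c1 h11).differentiable one_ne_zero
  have d22 := (contDiff_pd2 c2 h11).differentiable one_ne_zero
  have e := pd1_pd2_comm hg2
  have e1 : pd1 (pd1 (pd2 g)) = pd2 (pd1 (pd1 g)) := by rw [e, pd1_pd2_comm c1]
  have e2 : pd2 (pd2 (pd1 g)) = pd1 (pd2 (pd2 g)) := by rw [← e, pd1_pd2_comm c2]
  have s1 : pd1 (staticComponent c g) = fun x y =>
      -(c / 2) * y ^ 2 * pd1 (pd1 g) x y + (c * y * pd2 g x y + c * x * y * pd1 (pd2 g) x y) := by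
    funext x y
    have hl : HasDerivAt (fun x => c * x * y) (c * y) x := by
      simpa using ((hasDerivAt_id x).const_mul c).mul_const y
    exact (((hasDerivAt_pd1 d1 x y).const_mul _).add (hl.mul (hasDerivAt_pd1 d2 x y))).deriv
  have s2 : pd2 (staticComponent c g) = fun x y =>
      (-(c * y) * pd1 g x y + -(c / 2) * y ^ 2 * pd2 (pd1 g) x y) +
        (c * x * pd2 g x y + c * x * y * pd2 (pd2 g) x y) := by
    funext x y
    have hq : HasDerivAt (fun y => -(c / 2) * y ^ 2) (-(c * y)) y :=
      ((hasDerivAt_pow 2 y).const_mul _).congr_deriv (by norm_num; ring)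
    have hl : HasDerivAt (fun y => c * x * y) (c * x) y := by
      simpa using (hasDerivAt_id y).const_mul (c * x)
    exact ((hq.mul (hasDerivAt_pd2 d1 x y)).add (hl.mul (hasDerivAt_pd2 d2 x y))).deriv
  have s11 : pd1 (pd1 (staticComponent c g)) a b =
      -(c / 2) * b ^ 2 * pd1 (pd1 (pd1 g)) a b + (c * b * pd1 (pd2 g) a b +
        (c * b * pd1 (pd2 g) a b + c * a * b * pd1 (pd1 (pd2 g)) a b)) := by
    have hl : HasDerivAt (fun x => c * x * b) (c * b) a := by
      simpa using ((hasDerivAt_id a).const_mul c).mul_const b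
    rw [s1]
    exact (((hasDerivAt_pd1 d11 a b).const_mul _).add
      (((hasDerivAt_pd1 d2 a b).const_mul _).add (hl.mul (hasDerivAt_pd1 d12 a b)))).deriv
  have s22 : pd2 (pd2 (staticComponent c g)) a b =
      ((-c * pd1 g a b + -(c * b) * pd2 (pd1 g) a b) +
          (-(c * b) * pd2 (pd1 g) a b + -(c / 2) * b ^ 2 * pd2 (pd2 (pd1 g)) a b)) +
        (c * a * pd2 (pd2 g) a b +
          (c * a * pd2 (pd2 g) a b + c * a * b * pd2 (pd2 (pd2 g)) a b)) := by
    have hq : HasDerivAt (fun y => -(c / 2) * y ^ 2) (-(c * b)) b :=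
      ((hasDerivAt_pow 2 b).const_mul _).congr_deriv (by norm_num; ring)
    have hm : HasDerivAt (fun y => -(c * y)) (-c) b := by
      simpa using ((hasDerivAt_id b).const_mul c).fun_neg
    have hl : HasDerivAt (fun y => c * a * y) (c * a) b := by
      simpa using (hasDerivAt_id b).const_mul (c * a)
    rw [s2]
    exact (((hm.mul (hasDerivAt_pd2 d1 a b)).add (hq.mul (hasDerivAt_pd2 d21 a b))).add
      (((hasDerivAt_pd2 d2 a b).const_mul _).add (hl.mul (hasDerivAt_pd2 d22 a b)))).deriv
  have l1 : pd1 (lap g) a b = pd1 (pd1 (pd1 g)) a b + pd1 (pd2 (pd2 g)) a b :=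
    ((hasDerivAt_pd1 d11 a b).add (hasDerivAt_pd1 d22 a b)).deriv
  have l2 : pd2 (lap g) a b = pd2 (pd1 (pd1 g)) a b + pd2 (pd2 (pd2 g)) a b :=
    ((hasDerivAt_pd2 d11 a b).add (hasDerivAt_pd2 d22 a b)).deriv
  rw [lap, s11, s22, staticComponent, l1, l2, e1, e2, e]
  ring

theorem linearized_staticComponent {F U V W : ℝ → ℝ → ℝ}
    (hF : ContDiff ℝ 1 (Function.uncurry F)) (hU : ContDiff ℝ 1 (Function.uncurry U))
    (hV : ContDiff ℝ 1 (Function.uncurry V)) (hW : ContDiff ℝ 3 (Function.uncurry W))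
    (hpde : ∀ a b : ℝ, lap W a b + F (U a b) (V a b) = 0) (c a b : ℝ) :
    lap (staticComponent c W) a b + pd1 F (U a b) (V a b) * staticComponent c U a b
        + pd2 F (U a b) (V a b) * staticComponent c V a b
      = -c * (pd1 W a b - 2 * a * pd2 (pd2 W) a b) := by
  have hF' := hF.differentiable one_ne_zero
  have hU' := hU.differentiable one_ne_zero
  have hV' := hV.differentiable one_ne_zero
  have hlap : lap W = fun x y => -F (U x y) (V x y) := by
    funext x y
    exact eq_neg_of_add_eq_zero_left (hpde x y)
  have h1 : pd1 (lap W) a b = -pd1 (fun x y => F (U x y) (V x y)) a b := by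
    rw [hlap]; exact deriv.fun_neg
  have h2 : pd2 (lap W) a b = -pd2 (fun x y => F (U x y) (V x y)) a b := by
    rw [hlap]; exact deriv.fun_neg
  rw [lap_staticComponent hW, staticComponent, h1, h2, pd1_comp hF' hU' hV',
    pd2_comp hF' hU' hV', staticComponent, staticComponent]
  ring

end StaticComponent

/-- The static-component lemma: if `ΔU₀ + F(U₀,V₀) = 0` and `ΔV₀ + H(U₀,V₀) = 0`
on `ℝ²`, and `U₁ = −(c/2) s₂² ∂₁U₀ + c s₁ s₂ ∂₂U₀`,
`V₁ = −(c/2) s₂² ∂₁V₀ + c s₁ s₂ ∂₂V₀`, then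
`ΔU₁ + F_U U₁ + F_V V₁ = −c (∂₁U₀ − 2 s₁ ∂₂∂₂U₀)` and
`ΔV₁ + H_U U₁ + H_V V₁ = −c (∂₁V₀ − 2 s₁ ∂₂∂₂V₀)` everywhere on `ℝ²`. -/
theorem static_component_lemma
    (F H U₀ V₀ : ℝ → ℝ → ℝ)
    (hF : ContDiff ℝ 1 (Function.uncurry F)) (hH : ContDiff ℝ 1 (Function.uncurry H))
    (hU : ContDiff ℝ 3 (Function.uncurry U₀)) (hV : ContDiff ℝ 3 (Function.uncurry V₀))
    (hpdeU : ∀ a b : ℝ, lap U₀ a b + F (U₀ a b) (V₀ a b) = 0)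
    (hpdeV : ∀ a b : ℝ, lap V₀ a b + H (U₀ a b) (V₀ a b) = 0)
    (c : ℝ) (U₁ V₁ : ℝ → ℝ → ℝ)
    (hU₁ : U₁ = fun s₁ s₂ => -(c / 2) * s₂ ^ 2 * pd1 U₀ s₁ s₂ + c * s₁ * s₂ * pd2 U₀ s₁ s₂)
    (hV₁ : V₁ = fun s₁ s₂ => -(c / 2) * s₂ ^ 2 * pd1 V₀ s₁ s₂ + c * s₁ * s₂ * pd2 V₀ s₁ s₂) :
    ∀ s₁ s₂ : ℝ,
      (lap U₁ s₁ s₂ + pd1 F (U₀ s₁ s₂) (V₀ s₁ s₂) * U₁ s₁ s₂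
          + pd2 F (U₀ s₁ s₂) (V₀ s₁ s₂) * V₁ s₁ s₂
        = -c * (pd1 U₀ s₁ s₂ - 2 * s₁ * pd2 (pd2 U₀) s₁ s₂))
      ∧ (lap V₁ s₁ s₂ + pd1 H (U₀ s₁ s₂) (V₀ s₁ s₂) * U₁ s₁ s₂
          + pd2 H (U₀ s₁ s₂) (V₀ s₁ s₂) * V₁ s₁ s₂
        = -c * (pd1 V₀ s₁ s₂ - 2 * s₁ * pd2 (pd2 V₀) s₁ s₂)) := by
  subst hU₁ hV₁
  have h13 : (1 : WithTop ℕ∞) ≤ 3 := by norm_num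
  exact fun s₁ s₂ =>
    ⟨linearized_staticComponent hF (hU.of_le h13) (hV.of_le h13) hU hpdeU c s₁ s₂,
      linearized_staticComponent hH (hU.of_le h13) (hV.of_le h13) hV hpdeV c s₁ s₂⟩
end

section
/- Let E > 0 and A < 0 be real constants, and let x₁, x₂ : [0,∞) → ℝ³ be differentiable with |x₁(σ)| = |x₂(σ)| = 1 and x₁(σ) ≠ x₂(σ) for all σ ≥ 0, satisfying the two-spot system x₁′ = (2E/A)(I − x₁x₁ᵀ) x₂/|x₂ − x₁|² and x₂′ = (2E/A)(I − x₂x₂ᵀ) x₁/|x₁ − x₂|². Then for all σ ≥ 0, 1 + ⟨x₁(σ), x₂(σ)⟩ = (1 + ⟨x₁(0), x₂(0)⟩) · exp(2Eσ/A); equivalently, since 1 + cos γ₁,₂ = 2cos²(γ₁,₂/2), one has cos(γ₁,₂(σ)/2) = cos(γ₁,₂(0)/2) e^{−Eσ/|A|}. In particular ⟨x₁(σ), x₂(σ)⟩ → −1 as σ → ∞, i.e., the steady-state two-spot pattern has spots at antipodal points for any initial configuration. -/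
open Matrix Filter

theorem HasDerivAt.dotProduct_real {ι : Type*} [Fintype ι] {f g : ℝ → ι → ℝ} {f' g' : ι → ℝ}
    {t : ℝ} (hf : HasDerivAt f f' t) (hg : HasDerivAt g g' t) :
    HasDerivAt (fun s => f s ⬝ᵥ g s) (f' ⬝ᵥ g t + f t ⬝ᵥ g') t := by
  rw [hasDerivAt_pi] at hf hg
  simpa only [dotProduct, Finset.sum_add_distrib] using
    HasDerivAt.fun_sum fun i (_ : i ∈ Finset.univ) => (hf i).fun_mul (hg i)

/-- A solution of `f' = k f` on `[0, ∞)` is `f 0 * exp (k t)`. -/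
theorem eq_mul_exp_of_hasDerivAt {f : ℝ → ℝ} {k : ℝ}
    (hf : ∀ t ∈ Set.Ici (0 : ℝ), HasDerivAt f (k * f t) t) {t : ℝ} (ht : 0 ≤ t) :
    f t = f 0 * Real.exp (k * t) := by
  have hg : ∀ s ∈ Set.Ici (0 : ℝ), HasDerivAt (fun u => f u * Real.exp (-(k * u))) 0 s := by
    intro s hs
    have he : HasDerivAt (fun u => Real.exp (-(k * u))) (Real.exp (-(k * s)) * -(k * 1)) s :=
      ((hasDerivAt_id' s).const_mul k).fun_neg.exp
    exact ((hf s hs).fun_mul he).congr_deriv (by ring)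
  have hconst := constant_of_has_deriv_right_zero
    (fun s hs => (hg s hs.1).continuousAt.continuousWithinAt)
    (fun s hs => (hg s hs.1).hasDerivWithinAt) t (Set.right_mem_Icc.2 ht)
  simp only [mul_zero, neg_zero, Real.exp_zero, mul_one] at hconst
  rw [← hconst, mul_assoc, ← Real.exp_add, neg_add_cancel, Real.exp_zero, mul_one]

theorem dotProduct_sub_self_of_unit {ι : Type*} [Fintype ι] {x y : ι → ℝ}
    (hx : x ⬝ᵥ x = 1) (hy : y ⬝ᵥ y = 1) : (y - x) ⬝ᵥ (y - x) = 2 * (1 - x ⬝ᵥ y) := by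
  rw [sub_dotProduct, dotProduct_sub, dotProduct_sub, hx, hy, dotProduct_comm y x]
  ring

theorem dotProduct_one_sub_vecMulVec_mulVec {ι : Type*} [Fintype ι] [DecidableEq ι]
    {x y : ι → ℝ} (hy : y ⬝ᵥ y = 1) :
    y ⬝ᵥ ((1 : Matrix ι ι ℝ) - vecMulVec x x) *ᵥ y = 1 - (x ⬝ᵥ y) ^ 2 := by
  rw [sub_mulVec, one_mulVec, vecMulVec_mulVec, dotProduct_sub, hy, dotProduct_smul,
    dotProduct_comm y x, op_smul_eq_smul, smul_eq_mul, sq]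

/-- Explicit solution of the two-spot slow dynamics: with common strength `E > 0`
and mobility `A < 0`, one has
`1 + ⟨x₁(σ), x₂(σ)⟩ = (1 + ⟨x₁(0), x₂(0)⟩) exp(2Eσ/A)` for all `σ ≥ 0`, and
`⟨x₁(σ), x₂(σ)⟩ → −1` as `σ → ∞`: the steady-state two-spot pattern has spots at
antipodal points for any initial configuration.  (Here `⟨x, y⟩ = x ⬝ᵥ y`.) -/
theorem two_spot_explicit_solution
    (E A : ℝ) (hE : 0 < E) (hA : A < 0)
    (x₁ x₂ : ℝ → Fin 3 → ℝ)
    (h1 : ∀ σ ∈ Set.Ici (0 : ℝ), x₁ σ ⬝ᵥ x₁ σ = 1)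
    (h2 : ∀ σ ∈ Set.Ici (0 : ℝ), x₂ σ ⬝ᵥ x₂ σ = 1)
    (hsep : ∀ σ ∈ Set.Ici (0 : ℝ), x₁ σ ≠ x₂ σ)
    (hx1 : ∀ σ ∈ Set.Ici (0 : ℝ), HasDerivAt x₁
      ((2 * E / (A * ((x₂ σ - x₁ σ) ⬝ᵥ (x₂ σ - x₁ σ)))) •
        ((1 : Matrix (Fin 3) (Fin 3) ℝ) - Matrix.vecMulVec (x₁ σ) (x₁ σ)).mulVec (x₂ σ)) σ)
    (hx2 : ∀ σ ∈ Set.Ici (0 : ℝ), HasDerivAt x₂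
      ((2 * E / (A * ((x₁ σ - x₂ σ) ⬝ᵥ (x₁ σ - x₂ σ)))) •
        ((1 : Matrix (Fin 3) (Fin 3) ℝ) - Matrix.vecMulVec (x₂ σ) (x₂ σ)).mulVec (x₁ σ)) σ) :
    (∀ σ ∈ Set.Ici (0 : ℝ),
      1 + x₁ σ ⬝ᵥ x₂ σ = (1 + x₁ 0 ⬝ᵥ x₂ 0) * Real.exp (2 * E * σ / A))
    ∧ Tendsto (fun σ => x₁ σ ⬝ᵥ x₂ σ) atTop (nhds (-1)) := by
  have hc : ∀ σ ∈ Set.Ici (0 : ℝ), HasDerivAt (fun s => 1 + x₁ s ⬝ᵥ x₂ s)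
      (2 * E / A * (1 + x₁ σ ⬝ᵥ x₂ σ)) σ := by
    intro σ hσ
    have hd₁ := dotProduct_sub_self_of_unit (h1 σ hσ) (h2 σ hσ)
    have hd₂ := dotProduct_sub_self_of_unit (h2 σ hσ) (h1 σ hσ)
    have hne : 1 - x₁ σ ⬝ᵥ x₂ σ ≠ 0 := by
      intro h
      rw [h, mul_zero, dotProduct_self_eq_zero, sub_eq_zero] at hd₁
      exact hsep σ hσ hd₁.symm
    refine (((hx1 σ hσ).dotProduct_real (hx2 σ hσ)).const_add 1).congr_deriv ?_
    rw [hd₁, hd₂, smul_dotProduct, dotProduct_smul, dotProduct_comm (_ *ᵥ _) (x₂ σ),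
      dotProduct_one_sub_vecMulVec_mulVec (h2 σ hσ),
      dotProduct_one_sub_vecMulVec_mulVec (h1 σ hσ), dotProduct_comm (x₂ σ) (x₁ σ),
      smul_eq_mul]
    have hA' := hA.ne
    field_simp
    ring
  have hsol : ∀ σ ∈ Set.Ici (0 : ℝ),
      1 + x₁ σ ⬝ᵥ x₂ σ = (1 + x₁ 0 ⬝ᵥ x₂ 0) * Real.exp (2 * E * σ / A) := by
    intro σ hσ
    rw [eq_mul_exp_of_hasDerivAt hc hσ, div_mul_eq_mul_div]
  refine ⟨hsol, ?_⟩
  have hk : 2 * E / A < 0 := div_neg_of_pos_of_neg (by positivity) hA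
  have hlim : Tendsto (fun σ => (1 + x₁ 0 ⬝ᵥ x₂ 0) * Real.exp (2 * E / A * σ) - 1)
      atTop (nhds (-1)) := by
    simpa using ((Real.tendsto_exp_atBot.comp
      (tendsto_id.const_mul_atTop_of_neg hk)).const_mul (1 + x₁ 0 ⬝ᵥ x₂ 0)).sub_const 1
  refine hlim.congr' ?_
  filter_upwards [eventually_ge_atTop 0] with σ hσ
  rw [div_mul_eq_mul_div, ← hsol σ hσ, add_sub_cancel_left]
end
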